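/- For all nonnegative integers n and k and every real number z, Σ_{m=0}^{n} (−1)^m · S(n,m) · ĉ_{m,k}(z) = Σ_{i=0}^{n} C(n,i) · (−1)^{n−i} · z^i · (n−i+1)^k, where C(n,i) denotes the binomial coefficient. -/

import Mathlib

/-- Unsigned Stirling numbers of the first kind:
`c(0,0)=1`, `c(n,m)=0` for `m>n` or (`n>0` and `m=0`), and `c(n+1,m)=n*c(n,m)+c(n,m-1)`. -/
def stirling1 : ℕ → ℕ → ℕ
  | 0, 0 => 1
  | 0, _ + 1 => 0
  | _ + 1, 0 => 0
  | n + 1, m + 1 => n * stirling1 n (m + 1) + stirling1 n m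

/-- Stirling numbers of the second kind:
`S(0,0)=1`, `S(n,m)=0` for `m>n` or (`n>0` and `m=0`), and `S(n+1,m)=m*S(n,m)+S(n,m-1)`. -/
def stirling2 : ℕ → ℕ → ℕ
  | 0, 0 => 1
  | 0, _ + 1 => 0
  | _ + 1, 0 => 0
  | n + 1, m + 1 => (m + 1) * stirling2 n (m + 1) + stirling2 n m

/-- Poly-Cauchy numbers of the second kind (negated upper index, unsigned):
`ĉ_{n,k} = Σ_{m=0}^n c(n,m)·(m+1)^k`. -/
def polyCauchy (n k : ℕ) : ℕ := ∑ m ∈ Finset.range (n + 1), stirling1 n m * (m + 1) ^ k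

/-- Poly-Cauchy polynomial (of the second kind, negated upper index, unsigned):
`ĉ_{n,k}(z) = Σ_{m=0}^n c(n,m) · Σ_{i=0}^m C(m,i)·(−1)^i·(m−i+1)^k·z^i`. -/
def polyCauchyPoly (n k : ℕ) (z : ℝ) : ℝ :=
  ∑ m ∈ Finset.range (n + 1), (stirling1 n m : ℝ) *
    ∑ i ∈ Finset.range (m + 1),
      (Nat.choose m i : ℝ) * (-1) ^ i * ((m - i + 1 : ℕ) : ℝ) ^ k * z ^ i

/-- Falling factorial `(z)_m = z(z−1)⋯(z−m+1)` of a real number. -/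
def fallFact (z : ℝ) (m : ℕ) : ℝ := ∏ j ∈ Finset.range m, (z - j)

theorem stirling1_eq_zero_of_lt : ∀ {n m : ℕ}, n < m → stirling1 n m = 0
  | 0, _ + 1, _ => by rw [stirling1]
  | n + 1, m + 1, h => by
    rw [stirling1, stirling1_eq_zero_of_lt (by omega : n < m + 1),
      stirling1_eq_zero_of_lt (by omega : n < m), mul_zero]

theorem stirling2_eq_zero_of_lt : ∀ {n m : ℕ}, n < m → stirling2 n m = 0
  | 0, _ + 1, _ => by rw [stirling2]
  | n + 1, m + 1, h => by
    rw [stirling2, stirling2_eq_zero_of_lt (by omega : n < m + 1),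
      stirling2_eq_zero_of_lt (by omega : n < m), mul_zero]

theorem mul_stirling1_zero_right (n : ℕ) : n * stirling1 n 0 = 0 := by
  cases n <;> simp [stirling1]

/-- The recurrence satisfied by the Stirling transform of the first kind. -/
theorem sum_stirling1_succ_mul {R : Type*} [CommRing R] (a : ℕ → R) (n : ℕ) :
    ∑ j ∈ Finset.range (n + 2), (stirling1 (n + 1) j : R) * a j
      = n * ∑ j ∈ Finset.range (n + 1), (stirling1 n j : R) * a j
        + ∑ j ∈ Finset.range (n + 1), (stirling1 n j : R) * a (j + 1) := by
  have hzero : (n : R) * stirling1 n 0 = 0 := by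
    exact_mod_cast congrArg (Nat.cast (R := R)) (mul_stirling1_zero_right n)
  have hshift : (n : R) * ∑ j ∈ Finset.range (n + 1), (stirling1 n j : R) * a j
      = n * ∑ j ∈ Finset.range (n + 1), (stirling1 n (j + 1) : R) * a (j + 1) := by
    have h := Finset.sum_range_succ (fun j => (stirling1 n j : R) * a j) (n + 1)
    rw [Finset.sum_range_succ', stirling1_eq_zero_of_lt (Nat.lt_succ_self n)] at h
    linear_combination -(n : R) * h + a 0 * hzero
  rw [hshift, Finset.sum_range_succ', Finset.mul_sum, ← Finset.sum_add_distrib]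
  simp only [stirling1, Nat.cast_zero, zero_mul, add_zero]
  refine Finset.sum_congr rfl fun j _ => ?_
  push_cast
  ring

/-- The recurrence satisfied by the alternating Stirling transform of the second kind. -/
theorem sum_alternating_stirling2_succ_mul {R : Type*} [CommRing R] (b : ℕ → R) (n : ℕ) :
    ∑ m ∈ Finset.range (n + 2), (-1) ^ m * (stirling2 (n + 1) m : R) * b m
      = ∑ m ∈ Finset.range (n + 1), (-1) ^ m * (stirling2 n m : R) * (m * b m - b (m + 1)) := by
  have hshift : ∑ m ∈ Finset.range (n + 1), (-1) ^ m * (stirling2 n m : R) * (m * b m)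
      = ∑ m ∈ Finset.range (n + 1),
          (-1) ^ (m + 1) * (stirling2 n (m + 1) : R) * ((m + 1) * b (m + 1)) := by
    have h := Finset.sum_range_succ
      (fun m => (-1) ^ m * (stirling2 n m : R) * (m * b m)) (n + 1)
    rw [Finset.sum_range_succ', stirling2_eq_zero_of_lt (Nat.lt_succ_self n)] at h
    push_cast at h
    linear_combination -h
  simp only [mul_sub, Finset.sum_sub_distrib]
  rw [hshift, Finset.sum_range_succ', ← Finset.sum_sub_distrib]
  simp only [stirling2, Nat.cast_zero, mul_zero, zero_mul, add_zero]
  refine Finset.sum_congr rfl fun m _ => ?_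
  push_cast
  ring

/-- Stirling inversion. -/
theorem sum_alternating_stirling2_mul_sum_stirling1 {R : Type*} [CommRing R]
    (a : ℕ → R) (n : ℕ) :
    ∑ m ∈ Finset.range (n + 1), (-1) ^ m * (stirling2 n m : R) *
        ∑ j ∈ Finset.range (m + 1), (stirling1 m j : R) * a j
      = (-1) ^ n * a n := by
  induction n generalizing a with
  | zero => simp [stirling1, stirling2]
  | succ n ih =>
    rw [sum_alternating_stirling2_succ_mul
      (fun m => ∑ j ∈ Finset.range (m + 1), (stirling1 m j : R) * a j)]
    simp only [sum_stirling1_succ_mul, sub_add_cancel_left, mul_neg, Finset.sum_neg_distrib]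
    rw [ih fun j => a (j + 1)]
    ring

theorem alternating_stirling2_polyCauchyPoly (n k : ℕ) (z : ℝ) :
    ∑ m ∈ Finset.range (n + 1), (-1 : ℝ) ^ m * (stirling2 n m : ℝ) * polyCauchyPoly m k z
      = ∑ i ∈ Finset.range (n + 1),
        (Nat.choose n i : ℝ) * (-1) ^ (n - i) * z ^ i * ((n - i + 1 : ℕ) : ℝ) ^ k := by
  simp only [polyCauchyPoly]
  rw [sum_alternating_stirling2_mul_sum_stirling1 (fun m => ∑ i ∈ Finset.range (m + 1),
    (Nat.choose m i : ℝ) * (-1) ^ i * ((m - i + 1 : ℕ) : ℝ) ^ k * z ^ i), Finset.mul_sum]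
  refine Finset.sum_congr rfl fun i hi => ?_
  have hin : i ≤ n := Nat.lt_succ_iff.mp (Finset.mem_range.mp hi)
  have hsign : (-1 : ℝ) ^ n * (-1) ^ i = (-1) ^ (n - i) := by
    nth_rw 1 [← Nat.sub_add_cancel hin]
    rw [pow_add, mul_assoc, ← mul_pow]
    simp
  rw [← hsign]
  ring
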